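/- There exists a universal constant C > 0 with the following property. Let (X,d_X) be a finite metric space with n points admitting a (τ,ρ)-triangle-LSO with ρ ≥ 1, and let f ≥ 1 be an integer. Then there is a set H of unordered pairs of points of X with |H| ≤ C·n·f·τ·(1 + log n) such that for every set F ⊆ X with |F| ≤ f and every x,y ∈ X \ F, there exists z ∈ X \ F with d_X(x,z) + d_X(z,y) ≤ 2ρ·d_X(x,y), where each of the pairs {x,z} and {z,y} is either degenerate (its two points coincide) or belongs to H. (In particular H is a 2-hop f-fault-tolerant 2ρ-spanner of X.) -/

import Mathlib

/-- If `p < q`, some scale `2 ^ k` separates `p` and `q` into adjacent dyadic blocks. -/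
theorem exists_adjacent_dyadic_blocks {p q : ℕ} (h : p < q) :
    ∃ k : ℕ, q / 2 ^ k = p / 2 ^ k + 1 := by
  have hex : ∃ K : ℕ, p / 2 ^ K = q / 2 ^ K := by
    refine ⟨q, ?_⟩
    rw [Nat.div_eq_of_lt Nat.lt_two_pow_self, Nat.div_eq_of_lt (h.trans Nat.lt_two_pow_self)]
  obtain ⟨K, hK, hmin⟩ : ∃ K : ℕ, p / 2 ^ K = q / 2 ^ K ∧ ∀ m < K, p / 2 ^ m ≠ q / 2 ^ m := by
    classical
    exact ⟨Nat.find hex, Nat.find_spec hex, fun m hm => Nat.find_min hex hm⟩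
  obtain _ | k := K
  · simp only [pow_zero, Nat.div_one] at hK
    omega
  · refine ⟨k, ?_⟩
    have hne := hmin k k.lt_succ_self
    have hle : p / 2 ^ k ≤ q / 2 ^ k := Nat.div_le_div_right h.le
    rw [pow_succ, ← Nat.div_div_eq_div_mul, ← Nat.div_div_eq_div_mul] at hK
    omega

/-- A finite linear order on `n` points has a monotone 2-hop `f`-fault-tolerant spanner with
`O(n f log n)` edges. -/
theorem exists_monotone_two_hop_of_linearOrder (X : Type*) [LinearOrder X] [Fintype X] (f : ℕ) :
    ∃ H : Finset (Sym2 X),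
      H.card ≤ Fintype.card X * ((Nat.log 2 (Fintype.card X) + 1) * ((f + 1) * 2)) ∧
      ∀ F : Finset X, F.card ≤ f → ∀ x y : X, x ∉ F → y ∉ F → x ≤ y →
        ∃ z : X, z ∉ F ∧ x ≤ z ∧ z ≤ y ∧ (x = z ∨ s(x, z) ∈ H) ∧ (z = y ∨ s(z, y) ∈ H) := by
  classical
  set n := Fintype.card X with hn
  let e : Fin n ≃o X := Fintype.orderIsoFinOfCardEq X rfl
  let edge : Fin n × ℕ × ℕ × Fin 2 → Sym2 X := fun t =>
    let c := (t.1.val / 2 ^ t.2.1 + t.2.2.2.val) * 2 ^ t.2.1 + t.2.2.1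
    s(e t.1, if h : c < n then e ⟨c, h⟩ else e t.1)
  let H : Finset (Sym2 X) := (Finset.univ ×ˢ (Finset.range (Nat.log 2 n + 1) ×ˢ
    (Finset.range (f + 1) ×ˢ (Finset.univ : Finset (Fin 2))))).image edge
  have mem_H : ∀ (p c : Fin n) (k j : ℕ) (i : Fin 2), k ≤ Nat.log 2 n → j ≤ f →
      c.val = (p.val / 2 ^ k + i.val) * 2 ^ k + j → s(e p, e c) ∈ H := by
    intro p c k j i hk hj hc
    refine Finset.mem_image.mpr ⟨(p, k, j, i), ?_, ?_⟩
    · simp only [Finset.mem_product, Finset.mem_univ, Finset.mem_range, true_and, and_true]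
      omega
    · simp only [edge, ← hc, c.isLt, dite_true]
  refine ⟨H, ?_, ?_⟩
  · refine Finset.card_image_le.trans (le_of_eq ?_)
    simp [Finset.card_product]
  · intro F hF x y hx hy hxy
    obtain rfl | hlt := hxy.eq_or_lt
    · exact ⟨x, hx, le_rfl, le_rfl, Or.inl rfl, Or.inl rfl⟩
    obtain ⟨p, rfl⟩ := e.surjective x
    obtain ⟨q, rfl⟩ := e.surjective y
    have hpq : p.val < q.val := e.lt_iff_lt.mp hlt
    obtain ⟨k, hk⟩ := exists_adjacent_dyadic_blocks hpq
    set b := q.val / 2 ^ k * 2 ^ k with hb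
    have hbq : b ≤ q.val := Nat.div_mul_le_self _ _
    have hpb : p.val < b := by
      rw [hb, hk, add_one_mul]
      exact Nat.lt_div_mul_add (Nat.two_pow_pos k)
    have hkn : k ≤ Nat.log 2 n := by
      refine Nat.le_log_of_pow_le one_lt_two (le_trans ?_ (hbq.trans q.isLt.le))
      rw [hb, hk]
      exact Nat.le_mul_of_pos_left _ (Nat.succ_pos _)
    have left_mem : ∀ c : Fin n, b ≤ c.val → c.val ≤ b + f → s(e p, e c) ∈ H := by
      intro c h₁ h₂
      refine mem_H p c k (c.val - b) 1 hkn (by omega) ?_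
      rw [Fin.val_one, ← hk, ← hb]
      omega
    have right_mem : ∀ c : Fin n, b ≤ c.val → c.val ≤ b + f → s(e c, e q) ∈ H := by
      intro c h₁ h₂
      rw [Sym2.eq_swap]
      refine mem_H q c k (c.val - b) 0 hkn (by omega) ?_
      rw [Fin.val_zero, add_zero, ← hb]
      omega
    by_cases hq : q.val ≤ b + f
    · exact ⟨e q, hy, hxy, le_rfl, Or.inr (left_mem q hbq hq), Or.inl rfl⟩
    · have hbn : ∀ j : Fin (f + 1), b + j.val < n := fun j => by omega
      let g : Fin (f + 1) ↪ X :=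
        ⟨fun j => e ⟨b + j.val, hbn j⟩, fun i j hij => by
          have := congrArg Fin.val (e.injective hij)
          simp only at this
          exact Fin.ext (by omega)⟩
      obtain ⟨z, hz, hzF⟩ : ∃ z ∈ Finset.univ.map g, z ∉ F := by
        refine Finset.exists_mem_notMem_of_card_lt_card ?_
        rw [Finset.card_map, Finset.card_univ, Fintype.card_fin]
        omega
      obtain ⟨j, -, rfl⟩ := Finset.mem_map.mp hz
      have hj : b + j.val ≤ b + f := by omega
      refine ⟨_, hzF, e.le_iff_le.mpr ?_, e.le_iff_le.mpr ?_,
        Or.inr (left_mem _ (Nat.le_add_right _ _) hj),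
        Or.inr (right_mem _ (Nat.le_add_right _ _) hj)⟩
      · exact Fin.le_def.mpr (by simp only; omega)
      · exact Fin.le_def.mpr (by simp only; omega)

/-- The relational form of `exists_monotone_two_hop_of_linearOrder`. -/
theorem exists_monotone_two_hop_of_isLinearOrder {X : Type*} [Fintype X] (r : X → X → Prop)
    (hr : IsLinearOrder X r) (f : ℕ) :
    ∃ H : Finset (Sym2 X),
      H.card ≤ Fintype.card X * ((Nat.log 2 (Fintype.card X) + 1) * ((f + 1) * 2)) ∧
      ∀ F : Finset X, F.card ≤ f → ∀ x y : X, x ∉ F → y ∉ F → r x y →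
        ∃ z : X, z ∉ F ∧ r x z ∧ r z y ∧ (x = z ∨ s(x, z) ∈ H) ∧ (z = y ∨ s(z, y) ∈ H) := by
  classical
  let _ : LinearOrder X :=
    { le := r
      le_refl := fun a => refl_of r a
      le_trans := fun a b c => trans_of r
      le_antisymm := fun a b => antisymm_of r
      le_total := fun a b => total_of r a b
      toDecidableLE := Classical.decRel r }
  exact exists_monotone_two_hop_of_linearOrder X f

theorem natLog_two_add_one_le (n : ℕ) :
    (Nat.log 2 n + 1 : ℝ) ≤ 2 * (1 + Real.log n) := by
  have hlog : 0 ≤ Real.log n := Real.log_natCast_nonneg n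
  have h := Real.natLog_le_logb n 2
  rw [Real.logb, Nat.cast_ofNat, le_div_iff₀ (Real.log_pos one_lt_two)] at h
  have := Real.log_two_gt_d9
  have : (0 : ℝ) ≤ Nat.log 2 n := Nat.cast_nonneg _
  nlinarith


/-- A `(τ, ρ)`-triangle-LSO for the distance function `dX` on `X`. -/
def IsTriangleLSO {X : Type*} (dX : X → X → ℝ) (τ ρ : ℝ) : Prop :=
  ∃ (m : ℕ) (σ : Fin m → X → X → Prop),
    (m : ℝ) ≤ τ ∧ (∀ i, IsLinearOrder X (σ i)) ∧
    ∀ x y : X, ∃ i : Fin m,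
      (σ i x y ∧ ∀ a b : X, σ i x a → σ i a b → σ i b y → dX a b ≤ ρ * dX x y) ∨
      (σ i y x ∧ ∀ a b : X, σ i y a → σ i a b → σ i b x → dX a b ≤ ρ * dX x y)

/-- **2-hop fault-tolerant spanner from a triangle-LSO.**  There is a universal constant
`C > 0` such that every finite metric space on `n` points admitting a `(τ, ρ)`-triangle-LSO
with `ρ ≥ 1` has, for every `f ≥ 1`, a 2-hop `f`-fault-tolerant `2ρ`-spanner with at most
`C·n·f·τ·(1 + log n)` edges. -/
theorem two_hop_fault_tolerant_spanner_from_triangle_LSO :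
    ∃ C : ℝ, 0 < C ∧
      ∀ (X : Type) [MetricSpace X] [Fintype X] (τ ρ : ℝ) (f : ℕ),
        1 ≤ ρ → 1 ≤ f →
        IsTriangleLSO (fun x y : X => dist x y) τ ρ →
        ∃ H : Finset (Sym2 X),
          (H.card : ℝ) ≤ C * Fintype.card X * f * τ * (1 + Real.log (Fintype.card X)) ∧
          ∀ F : Finset X, F.card ≤ f →
            ∀ x y : X, x ∉ F → y ∉ F →
              ∃ z : X, z ∉ F ∧
                dist x z + dist z y ≤ 2 * ρ * dist x y ∧
                (x = z ∨ s(x, z) ∈ H) ∧ (z = y ∨ s(z, y) ∈ H) := by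

  classical
  refine ⟨8, by norm_num, ?_⟩
  intro X _ _ τ ρ f hρ hf ⟨m, σ, hm, hσ, hcover⟩
  choose H hcard hH using fun i => exists_monotone_two_hop_of_isLinearOrder (σ i) (hσ i) f
  refine ⟨Finset.univ.biUnion H, ?_, ?_⟩
  · have hnat := Finset.card_biUnion_le_card_mul Finset.univ H _ fun i _ => hcard i
    rw [Finset.card_univ, Fintype.card_fin] at hnat
    have hreal : ((Finset.univ.biUnion H).card : ℝ) ≤
        m * (Fintype.card X * ((Nat.log 2 (Fintype.card X) + 1) * ((f + 1) * 2))) := by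
      exact_mod_cast hnat
    have hf' : (1 : ℝ) ≤ f := by exact_mod_cast hf
    have hlog := natLog_two_add_one_le (Fintype.card X)
    have hlog0 : 0 ≤ Real.log (Fintype.card X) := Real.log_natCast_nonneg _
    have hτ : 0 ≤ τ := (Nat.cast_nonneg m).trans hm
    calc ((Finset.univ.biUnion H).card : ℝ)
        ≤ m * (Fintype.card X * ((Nat.log 2 (Fintype.card X) + 1) * ((f + 1) * 2))) := hreal
      _ ≤ τ * (Fintype.card X * ((2 * (1 + Real.log (Fintype.card X))) * ((f + f) * 2))) := by
          gcongr
      _ = 8 * Fintype.card X * f * τ * (1 + Real.log (Fintype.card X)) := by ring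
  · have key : ∀ (i : Fin m) (F : Finset X), F.card ≤ f → ∀ x y : X, x ∉ F → y ∉ F → σ i x y →
        (∀ a b : X, σ i x a → σ i a b → σ i b y → dist a b ≤ ρ * dist x y) →
        ∃ z : X, z ∉ F ∧ dist x z + dist z y ≤ 2 * ρ * dist x y ∧
          (x = z ∨ s(x, z) ∈ Finset.univ.biUnion H) ∧
          (z = y ∨ s(z, y) ∈ Finset.univ.biUnion H) := by
      intro i F hF x y hx hy hxy hd
      have := hσ i
      obtain ⟨z, hz, hxz, hzy, h₁, h₂⟩ := hH i F hF x y hx hy hxy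
      have hsub : H i ⊆ Finset.univ.biUnion H :=
        Finset.subset_biUnion_of_mem H (Finset.mem_univ i)
      refine ⟨z, hz, ?_, h₁.imp_right fun h => hsub h, h₂.imp_right fun h => hsub h⟩
      linarith [hd x z (refl_of (σ i) x) hxz hzy, hd z y hxz hzy (refl_of (σ i) y)]
    intro F hF x y hx hy
    obtain ⟨i, ⟨hxy, hd⟩ | ⟨hyx, hd⟩⟩ := hcover x y
    · exact key i F hF x y hx hy hxy hd
    · obtain ⟨z, hz, hdist, h₁, h₂⟩ := key i F hF y x hy hx hyx fun a b ha hab hb => by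
        simpa only [dist_comm y x] using hd a b ha hab hb
      refine ⟨z, hz, ?_, ?_, ?_⟩
      · rw [dist_comm x z, dist_comm z y, dist_comm x y]
        linarith
      · rw [Sym2.eq_swap]
        exact h₂.imp_left Eq.symm
      · rw [Sym2.eq_swap]
        exact h₁.imp_left Eq.symm
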